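/- Let a and b be coprime positive integers and let d₀ ≥ 1, 0 ≤ d₁ ≤ d₀ be integers with (b−1)d₀ + d₁ ≥ 1. Then in ℤ[t,t⁻¹] the product (t^{d₀} − t^{−d₀})·(t^{(b−1)d₀+d₁} − t^{−((b−1)d₀+d₁)})·(t^{ad₀} − t^{−ad₀}) divides (t − t^{−1})² · Σ_{k∣gcd(d₀,d₁)} k·μ(k)·(−1)^{((a+b)d₀+d₁)/k + 1} · ( t^{ad₀((b−1)d₀+d₁)/k} − t^{−ad₀((b−1)d₀+d₁)/k} ) · [ ad₀/k choose (d₀−d₁)/k ]_{t^k}. (This is Theorem 2.3 of the paper for the three-component pair Y^{[3]}_{(a,b)}, i.e. integrality Ω_d(Y^{[3]}_{(a,b)})(q) ∈ ℤ[q^{±1/2}], combining the definition (2.10) of Ω_d with l = 3, the intersection numbers d·D₁ = d₀, d·D₂ = (b−1)d₀+d₁, d·D₃ = ad₀, and the closed form N^log_d(Y^{[3]}_{(a,b)})(q) = ([ad₀((b−1)d₀+d₁)]_q/[1]_q)·[ad₀ choose d₀−d₁]_q of Proposition 5.1.) -/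

import Mathlib

/-!
STATEMENT 4: BPS integrality for the three-component pair Y^{[3]}_{(a,b)}
(Theorem 2.3 of the paper). In ℤ[t,t⁻¹] the product
(t^{d₀} − t^{−d₀})·(t^{(b−1)d₀+d₁} − t^{−((b−1)d₀+d₁)})·(t^{ad₀} − t^{−ad₀}) divides
(t − t^{−1})² · Σ_{k∣gcd(d₀,d₁)} k·μ(k)·(−1)^{((a+b)d₀+d₁)/k + 1}
  · ( t^{ad₀((b−1)d₀+d₁)/k} − t^{−ad₀((b−1)d₀+d₁)/k} ) · [ ad₀/k choose (d₀−d₁)/k ]_{t^k}.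
-/

open Finset LaurentPolynomial ArithmeticFunction

noncomputable section

/-- Gaussian binomial coefficient `C_q(n, m) ∈ ℤ[q]`, defined by the q-Pascal recursion
`C_q(n+1, m+1) = C_q(n, m) + q^{m+1}·C_q(n, m+1)`; it vanishes for `m > n`. -/
def gaussBinom : ℕ → ℕ → Polynomial ℤ
  | _, 0 => 1
  | 0, _ + 1 => 0
  | n + 1, m + 1 => gaussBinom n m + Polynomial.X ^ (m + 1) * gaussBinom n (m + 1)

/-- The symmetrised q-integer `[n]_t = t^n − t^{−n}` in `ℤ[t,t⁻¹]`. -/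
def qint (n : ℤ) : LaurentPolynomial ℤ := T n - T (-n)

/-- The symmetrised q-binomial with the substitution `t ↦ t^k`:
`[n choose m]_{t^k} = t^{−k·m·(n−m)} · C_{t^{2k}}(n, m)` in `ℤ[t,t⁻¹]`. -/
def symmBinom (k : ℤ) (n m : ℕ) : LaurentPolynomial ℤ :=
  T (-(k * (m : ℤ) * ((n - m : ℕ) : ℤ))) * Polynomial.aeval (T (2 * k)) (gaussBinom n m)

/-! ### Gaussian binomial coefficients -/

lemma gaussBinom_zero_right (n : ℕ) : gaussBinom n 0 = 1 := by
  cases n <;> rfl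

lemma gaussBinom_zero_succ (m : ℕ) : gaussBinom 0 (m + 1) = 0 := rfl

lemma gaussBinom_succ_succ (n m : ℕ) :
    gaussBinom (n + 1) (m + 1) =
      gaussBinom n m + Polynomial.X ^ (m + 1) * gaussBinom n (m + 1) := rfl

lemma gaussBinom_eq_zero_of_lt {n m : ℕ} (h : n < m) : gaussBinom n m = 0 := by
  induction n generalizing m with
  | zero => obtain ⟨m, rfl⟩ := Nat.exists_eq_succ_of_ne_zero h.ne'; rfl
  | succ n ih =>
    obtain ⟨m, rfl⟩ := Nat.exists_eq_succ_of_ne_zero (Nat.ne_zero_of_lt h)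
    rw [Nat.succ_eq_add_one, gaussBinom_succ_succ, ih (by omega), ih (by omega)]
    simp

lemma gaussBinom_self (n : ℕ) : gaussBinom n n = 1 := by
  induction n with
  | zero => rfl
  | succ n ih => rw [gaussBinom_succ_succ, ih, gaussBinom_eq_zero_of_lt (by omega)]; simp

/-- Mirror form of the `q`-Pascal rule. -/
lemma gaussBinom_succ_succ_mirror (m r : ℕ) :
    gaussBinom (m + r + 1) (m + 1) =
      Polynomial.X ^ r * gaussBinom (m + r) m + gaussBinom (m + r) (m + 1) := by
  induction r generalizing m with
  | zero =>
    rw [add_zero, gaussBinom_self, gaussBinom_self, gaussBinom_eq_zero_of_lt (by omega)]; simp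
  | succ r ihr =>
    induction m with
    | zero =>
      have h := ihr 0
      rw [gaussBinom_zero_right] at h ⊢
      rw [show 0 + (r + 1) + 1 = (0 + r + 1) + 1 by ring, gaussBinom_succ_succ,
        gaussBinom_zero_right, show 0 + (r + 1) = (0 + r) + 1 by ring, gaussBinom_succ_succ,
        gaussBinom_zero_right]
      rw [gaussBinom_succ_succ, gaussBinom_zero_right] at h
      linear_combination Polynomial.X * h
    | succ m ihm =>
      have h := ihr (m + 1)
      rw [show m + 1 + (r + 1) + 1 = (m + 1 + r + 1) + 1 by ring, gaussBinom_succ_succ, h]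
      have h1 : gaussBinom (m + 1 + r + 1) (m + 1) =
          Polynomial.X ^ (r + 1) * gaussBinom (m + (r + 1)) m
            + gaussBinom (m + (r + 1)) (m + 1) := by
        rw [← ihm]; congr 1; ring
      rw [h1, show m + 1 + (r + 1) = (m + (r + 1)) + 1 by ring, gaussBinom_succ_succ,
        gaussBinom_succ_succ, show m + 1 + r = m + (r + 1) by ring]
      ring

/-- Absorption: `(1 - q^(m+1)) C_q(n+1, m+1) = (1 - q^(n+1)) C_q(n, m)`. -/
lemma one_sub_mul_gaussBinom (n m : ℕ) :
    (1 - Polynomial.X ^ (m + 1)) * gaussBinom (n + 1) (m + 1) =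
      (1 - Polynomial.X ^ (n + 1)) * gaussBinom n m := by
  rcases lt_or_ge n m with h | h
  · rw [gaussBinom_eq_zero_of_lt h, gaussBinom_eq_zero_of_lt (by omega)]; simp
  · obtain ⟨r, rfl⟩ := Nat.exists_eq_add_of_le h
    have h1 := gaussBinom_succ_succ (m + r) m
    have h2 := gaussBinom_succ_succ_mirror m r
    linear_combination h1 - Polynomial.X ^ (m + 1) * h2

/-- The `q`-Vandermonde convolution. -/
lemma gaussBinom_add (N n M : ℕ) :
    gaussBinom (N + n) M = ∑ x ∈ antidiagonal M,
      gaussBinom N x.1 * gaussBinom n x.2 * Polynomial.X ^ (x.1 * (n - x.2)) := by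
  induction n generalizing M with
  | zero =>
    rw [Finset.sum_eq_single (M, 0)]
    · simp [gaussBinom_zero_right]
    · rintro ⟨i, j⟩ hij hne
      rcases j with _ | j
      · simp_all
      · simp [gaussBinom_zero_succ]
    · simp
  | succ n ih =>
    rcases M with _ | M
    · simp [gaussBinom_zero_right]
    · rw [← add_assoc, gaussBinom_succ_succ, ih, ih, Finset.mul_sum,
        Finset.Nat.sum_antidiagonal_succ', Finset.Nat.sum_antidiagonal_succ']
      have key : ∀ x ∈ antidiagonal M,
          gaussBinom N x.1 * gaussBinom (n + 1) (x.2 + 1) *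
              Polynomial.X ^ (x.1 * (n + 1 - (x.2 + 1))) =
            gaussBinom N x.1 * gaussBinom n x.2 * Polynomial.X ^ (x.1 * (n - x.2)) +
            Polynomial.X ^ (M + 1) * (gaussBinom N x.1 * gaussBinom n (x.2 + 1) *
              Polynomial.X ^ (x.1 * (n - (x.2 + 1)))) := by
        rintro ⟨i, j⟩ hij
        obtain rfl : i + j = M := by simpa using hij
        dsimp only
        rw [gaussBinom_succ_succ, Nat.add_sub_add_right]
        rcases lt_or_ge n (j + 1) with h | h
        · rw [gaussBinom_eq_zero_of_lt h]; ring
        · obtain ⟨r, rfl⟩ := Nat.exists_eq_add_of_le h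
          rw [show j + 1 + r - j = r + 1 by omega, Nat.add_sub_cancel_left]
          ring
      rw [Finset.sum_congr rfl key, Finset.sum_add_distrib]
      simp only [gaussBinom_zero_right, Nat.sub_zero, ← Finset.mul_sum]
      ring

/-! ### Local expansions at a nonzero complex number -/

/-- The expansion of a Laurent polynomial at `ζ`: substitute `t = ζ · exp h`. -/
def expandAt (ζ : ℂˣ) : LaurentPolynomial ℤ →ₐ[ℤ] PowerSeries ℂ :=
  AddMonoidAlgebra.lift ℤ (PowerSeries ℂ) ℤ
    { toFun := fun n => PowerSeries.C ((ζ : ℂ) ^ n.toAdd) *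
        PowerSeries.rescale (n.toAdd : ℂ) (PowerSeries.exp ℂ)
      map_one' := by
        ext n
        rcases n with _ | n <;> simp [PowerSeries.coeff_one]
      map_mul' := fun m n => by
        rw [toAdd_mul, zpow_add₀ ζ.ne_zero, Int.cast_add, map_mul,
          ← PowerSeries.exp_mul_exp_eq_exp_add]
        ring }

lemma expandAt_T (ζ : ℂˣ) (n : ℤ) :
    expandAt ζ (T n) =
      PowerSeries.C ((ζ : ℂ) ^ n) * PowerSeries.rescale (n : ℂ) (PowerSeries.exp ℂ) := by
  exact (AddMonoidAlgebra.lift_single ..).trans (one_smul ℤ _)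

lemma coeff_zero_expandAt_T (ζ : ℂˣ) (n : ℤ) :
    PowerSeries.coeff 0 (expandAt ζ (T n)) = (ζ : ℂ) ^ n := by
  simp [expandAt_T]

lemma coeff_one_expandAt_T (ζ : ℂˣ) (n : ℤ) :
    PowerSeries.coeff 1 (expandAt ζ (T n)) = n * (ζ : ℂ) ^ n := by
  simp [expandAt_T, PowerSeries.coeff_C_mul, PowerSeries.coeff_exp]
  ring

lemma coeff_two_expandAt_T (ζ : ℂˣ) (n : ℤ) :
    PowerSeries.coeff 2 (expandAt ζ (T n)) = n ^ 2 / 2 * (ζ : ℂ) ^ n := by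
  simp [expandAt_T, PowerSeries.coeff_C_mul, PowerSeries.coeff_exp]
  ring

lemma constantCoeff_aeval (s : PowerSeries ℂ) (p : Polynomial ℂ) :
    PowerSeries.constantCoeff (Polynomial.aeval s p) =
      p.eval (PowerSeries.constantCoeff s) := by
  rw [Polynomial.aeval_def, Polynomial.hom_eval₂]
  exact Polynomial.eval₂_id ..

lemma expandAt_toLaurent (ζ : ℂˣ) (p : Polynomial ℤ) :
    expandAt ζ (Polynomial.toLaurent p) =
      Polynomial.aeval (expandAt ζ (T 1)) (p.map (Int.castRingHom ℂ)) := by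
  rw [← algebraMap_int_eq, Polynomial.aeval_map_algebraMap]
  have h : ((expandAt ζ).comp Polynomial.toLaurentAlg) =
      Polynomial.aeval (expandAt ζ (T 1)) := by
    ext1
    simp
  exact DFunLike.congr_fun h p

/-- Expanding a polynomial at `ζ` gives a power series whose order is the multiplicity of `ζ`. -/
lemma associated_aeval_expandAt (ζ : ℂˣ) {p : Polynomial ℂ} (hp : p ≠ 0) :
    Associated (PowerSeries.X ^ p.rootMultiplicity (ζ : ℂ))
      (Polynomial.aeval (expandAt ζ (T 1)) p) := by
  have hs : PowerSeries.constantCoeff (expandAt ζ (T 1)) = ζ := by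
    simpa using coeff_zero_expandAt_T ζ 1
  obtain ⟨g, hg, hdvd⟩ := Polynomial.exists_eq_pow_rootMultiplicity_mul_and_not_dvd p hp (ζ : ℂ)
  have hX : Associated (PowerSeries.X : PowerSeries ℂ)
      (Polynomial.aeval (expandAt ζ (T 1)) (Polynomial.X - Polynomial.C (ζ : ℂ))) := by
    have h0 : (PowerSeries.X : PowerSeries ℂ) ∣
        Polynomial.aeval (expandAt ζ (T 1)) (Polynomial.X - Polynomial.C (ζ : ℂ)) := by
      rw [PowerSeries.X_dvd_iff, constantCoeff_aeval, hs]; simp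
    obtain ⟨v, hv⟩ := h0
    have hv1 : PowerSeries.constantCoeff v = ζ := by
      have h1 := congrArg (PowerSeries.coeff (0 + 1)) hv
      rw [PowerSeries.coeff_succ_X_mul, zero_add, map_sub, map_sub, Polynomial.aeval_X,
        coeff_one_expandAt_T, Polynomial.aeval_C] at h1
      simpa [PowerSeries.algebraMap_apply, PowerSeries.coeff_C] using h1.symm
    rw [hv]
    exact (associated_mul_unit_right _ _ (PowerSeries.isUnit_iff_constantCoeff.2
      (by rw [hv1]; exact ζ.isUnit)))
  have hgu : IsUnit (Polynomial.aeval (expandAt ζ (T 1)) g) := by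
    rw [PowerSeries.isUnit_iff_constantCoeff, constantCoeff_aeval, hs, isUnit_iff_ne_zero]
    rwa [Polynomial.dvd_iff_isRoot] at hdvd
  conv_rhs => rw [hg]
  rw [map_mul, map_pow]
  exact (hX.pow_pow).trans (associated_mul_unit_right _ _ hgu)

/-- Divisibility of integral polynomials can be tested on all local expansions. -/
lemma dvd_of_expandAt_dvd {p q : Polynomial ℤ} (hp : p.Monic) (hp0 : p.coeff 0 ≠ 0)
    (h : ∀ ζ : ℂˣ, expandAt ζ (Polynomial.toLaurent p) ∣ expandAt ζ (Polynomial.toLaurent q)) :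
    p ∣ q := by
  have hinj : Function.Injective (Int.castRingHom ℂ) := Int.cast_injective
  rw [← Polynomial.map_dvd_map _ hinj hp]
  rcases eq_or_ne q 0 with rfl | hq
  · simp
  have hp' := (Polynomial.map_ne_zero_iff hinj).2 hp.ne_zero
  have hq' := (Polynomial.map_ne_zero_iff hinj).2 hq
  classical
  rw [IsAlgClosed.dvd_iff_roots_le_roots hp' hq', Multiset.le_iff_count]
  intro z
  rw [Polynomial.count_roots, Polynomial.count_roots]
  rcases eq_or_ne z 0 with rfl | hz
  · rw [Polynomial.rootMultiplicity_eq_zero]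
    · exact Nat.zero_le _
    · simpa [Polynomial.IsRoot, ← Polynomial.coeff_zero_eq_eval_zero] using hp0
  · have hz' := h (Units.mk0 z hz)
    rw [expandAt_toLaurent, expandAt_toLaurent,
      ← (associated_aeval_expandAt _ hp').dvd_iff_dvd_left,
      ← (associated_aeval_expandAt _ hq').dvd_iff_dvd_right] at hz'
    exact (pow_dvd_pow_iff PowerSeries.X_ne_zero PowerSeries.X_prime.not_isUnit).1 hz'

lemma qint_eq_T_mul (n : ℕ) :
    qint n = T (-n) * Polynomial.toLaurent (Polynomial.X ^ (2 * n) - 1) := by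
  simp only [qint, map_sub, Polynomial.toLaurent_X_pow, map_one, mul_sub, ← T_add, mul_one]
  congr 2; push_cast; ring

/-- Divisibility by a product of three `q`-integers can be tested on all local expansions. -/
lemma qint_mul_dvd_of_expandAt_dvd {x y z : ℕ} (hx : x ≠ 0) (hy : y ≠ 0) (hz : z ≠ 0)
    {f : LaurentPolynomial ℤ}
    (h : ∀ ζ : ℂˣ, expandAt ζ (qint x * qint y * qint z) ∣ expandAt ζ f) :
    qint x * qint y * qint z ∣ f := by
  obtain ⟨N, F, hF⟩ := exists_T_pow f
  have hmonic : ∀ {n : ℕ}, n ≠ 0 → (Polynomial.X ^ (2 * n) - 1 : Polynomial ℤ).Monic :=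
    fun hn => Polynomial.monic_X_pow_sub_C 1 (by omega)
  obtain ⟨D, hD⟩ : ∃ D : Polynomial ℤ, D = (Polynomial.X ^ (2 * x) - 1) *
    (Polynomial.X ^ (2 * y) - 1) * (Polynomial.X ^ (2 * z) - 1) := ⟨_, rfl⟩
  have hdec : qint x * qint y * qint z = T (-(x + y + z)) * Polynomial.toLaurent D := by
    rw [qint_eq_T_mul, qint_eq_T_mul, qint_eq_T_mul, hD, map_mul, map_mul,
      show (-(x + y + z) : ℤ) = -x + -y + -z by ring, T_add, T_add]
    ring
  rw [hdec, (isUnit_T _).mul_left_dvd]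
  rw [← (isUnit_T (N : ℤ)).dvd_mul_right, ← hF]
  have hDm : D.Monic := hD ▸ ((hmonic hx).mul (hmonic hy)).mul (hmonic hz)
  refine map_dvd _ (dvd_of_expandAt_dvd hDm ?_ ?_)
  · simp [hD, Polynomial.mul_coeff_zero, Polynomial.coeff_X_pow, hx, hy, hz]
  · intro ζ
    have h1 := h ζ
    rw [hdec, map_mul, ((isUnit_T _).map (expandAt ζ)).mul_left_dvd] at h1
    rw [hF, map_mul]
    exact h1.mul_right _

/-! ### Expansions of `q`-integers and `q`-binomials -/

lemma isUnit_expandAt_qint (ζ : ℂˣ) {n : ℕ} (h : (ζ ^ 2) ^ n ≠ 1) :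
    IsUnit (expandAt ζ (qint n)) := by
  rw [PowerSeries.isUnit_iff_constantCoeff, isUnit_iff_ne_zero,
    ← PowerSeries.coeff_zero_eq_constantCoeff_apply, qint, map_sub, map_sub,
    coeff_zero_expandAt_T, coeff_zero_expandAt_T, sub_ne_zero]
  intro h1
  apply h
  ext
  push_cast
  have h2 := ζ.ne_zero
  rw [zpow_neg, zpow_natCast, ← mul_eq_one_iff_eq_inv₀ (pow_ne_zero _ h2)] at h1
  rw [← h1]
  ring

lemma zpow_neg_eq_pow (ζ : ℂˣ) {n : ℕ} (h : (ζ ^ 2) ^ n = 1) :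
    (ζ : ℂ) ^ (-n : ℤ) = (ζ : ℂ) ^ n := by
  have h2 := ζ.ne_zero
  have h1 : ((ζ : ℂ) ^ 2) ^ n = 1 := by
    simpa using congrArg Units.val h
  rw [zpow_neg, zpow_natCast, inv_eq_iff_eq_inv, ← mul_eq_one_iff_eq_inv₀ (pow_ne_zero _ h2),
    ← h1]
  ring

lemma coeff_expandAt_qint (ζ : ℂˣ) {n : ℕ} (h : (ζ ^ 2) ^ n = 1) :
    PowerSeries.coeff 0 (expandAt ζ (qint n)) = 0 ∧
    PowerSeries.coeff 1 (expandAt ζ (qint n)) = 2 * n * (ζ : ℂ) ^ n ∧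
    PowerSeries.coeff 2 (expandAt ζ (qint n)) = 0 := by
  simp only [qint, map_sub, coeff_zero_expandAt_T, coeff_one_expandAt_T, coeff_two_expandAt_T,
    zpow_neg_eq_pow ζ h, zpow_natCast]
  refine ⟨by ring, ?_, ?_⟩ <;> push_cast <;> ring

lemma X_dvd_expandAt_qint (ζ : ℂˣ) {n : ℕ} (h : (ζ ^ 2) ^ n = 1) :
    PowerSeries.X ∣ expandAt ζ (qint n) := by
  rw [PowerSeries.X_dvd_iff, ← PowerSeries.coeff_zero_eq_constantCoeff_apply]
  exact (coeff_expandAt_qint ζ h).1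

lemma expandAt_qint_dvd_X (ζ : ℂˣ) {n : ℕ} (hn : n ≠ 0) :
    expandAt ζ (qint n) ∣ PowerSeries.X := by
  by_cases h : (ζ ^ 2) ^ n = 1
  · obtain ⟨v, hv⟩ := X_dvd_expandAt_qint ζ h
    have h1 := (coeff_expandAt_qint ζ h).2.1
    rw [hv, PowerSeries.coeff_succ_X_mul 0] at h1
    have hvu : IsUnit v := by
      rw [PowerSeries.isUnit_iff_constantCoeff, isUnit_iff_ne_zero,
        ← PowerSeries.coeff_zero_eq_constantCoeff_apply, h1]
      have h2 := pow_ne_zero n ζ.ne_zero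
      have h3 : (n : ℂ) ≠ 0 := Nat.cast_ne_zero.2 hn
      simp [h3]
    rw [hv, hvu.mul_right_dvd]
  · exact (isUnit_expandAt_qint ζ h).dvd

lemma coeff_one_pow_of_coeff_one {q : PowerSeries ℂ} {w c : ℂ}
    (h0 : PowerSeries.constantCoeff q = w) (h1 : PowerSeries.coeff 1 q = c * w) (r : ℕ) :
    PowerSeries.coeff 1 (q ^ r) = r * c * w ^ r := by
  rcases r with _ | r
  · simp [PowerSeries.coeff_one]
  · rw [PowerSeries.coeff_one_pow, h0, h1]
    simp
    ring

lemma constantCoeff_gaussBinom_eq_zero {q : PowerSeries ℂ} {w : ℂ}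
    (h0 : PowerSeries.constantCoeff q = w) {N M : ℕ} (hN : w ^ N = 1) (hM : w ^ M ≠ 1) :
    PowerSeries.constantCoeff (Polynomial.aeval q (gaussBinom N M)) = 0 := by
  rcases M with _ | M
  · simp at hM
  rcases N with _ | N
  · simp [gaussBinom_zero_succ]
  have h := congrArg (fun p => PowerSeries.constantCoeff (Polynomial.aeval q p))
    (one_sub_mul_gaussBinom N M)
  simp only [map_mul, map_sub, map_one, map_pow, Polynomial.aeval_X, h0, hN, sub_self,
    zero_mul, mul_eq_zero] at h
  exact h.resolve_left (sub_ne_zero.2 hM.symm)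

/-- First-order expansion of `C_q(nA, nM)` near a primitive `n`-th root of unity. -/
lemma coeff_gaussBinom_mul_mul {q : PowerSeries ℂ} {w c : ℂ}
    (h0 : PowerSeries.constantCoeff q = w) (h1 : PowerSeries.coeff 1 q = c * w) {n : ℕ}
    (hn : 0 < n) (hw : IsPrimitiveRoot w n) (A M : ℕ) :
    PowerSeries.constantCoeff (Polynomial.aeval q (gaussBinom (n * A) (n * M))) = A.choose M ∧
    PowerSeries.coeff 1 (Polynomial.aeval q (gaussBinom (n * A) (n * M))) =
      c * n ^ 2 / 2 * M * (A - M) * A.choose M := by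
  induction A generalizing M with
  | zero =>
    rcases M with _ | M
    · simp [gaussBinom_zero_right, PowerSeries.coeff_one]
    · rw [mul_zero, gaussBinom_eq_zero_of_lt (by positivity)]
      simp
  | succ A ih =>
    rcases M with _ | M
    · simp [gaussBinom_zero_right, PowerSeries.coeff_one]
    have hsum : Polynomial.aeval q (gaussBinom (n * (A + 1)) (n * (M + 1))) =
        ∑ x ∈ antidiagonal (n * (M + 1)), Polynomial.aeval q (gaussBinom (n * A) x.1) *
          Polynomial.aeval q (gaussBinom n x.2) * q ^ (x.1 * (n - x.2)) := by
      rw [mul_add_one, gaussBinom_add]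
      simp
    have hvanish : ∀ x ∈ antidiagonal (n * (M + 1)),
        x ≠ (n * (M + 1), 0) ∧ x ≠ (n * M, n) →
        PowerSeries.X ^ 2 ∣ Polynomial.aeval q (gaussBinom (n * A) x.1) *
          Polynomial.aeval q (gaussBinom n x.2) * q ^ (x.1 * (n - x.2)) := by
      rintro ⟨i, j⟩ hij ⟨hne1, hne2⟩
      rw [HasAntidiagonal.mem_antidiagonal] at hij
      dsimp only at hij ⊢
      rw [mul_add_one] at hij hne1
      rcases lt_or_ge n j with hj | hj
      · rw [gaussBinom_eq_zero_of_lt hj]; simp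
      have hj0 : j ≠ 0 := by
        rintro rfl; exact hne1 (by simp_all)
      have hjn : j ≠ n := by
        rintro rfl; exact hne2 (by simp_all)
      have hwj : w ^ j ≠ 1 := hw.pow_ne_one_of_pos_of_lt hj0 (by omega)
      have hwi : w ^ i ≠ 1 := by
        intro hi
        apply hwj
        have h2 : w ^ (i + j) = 1 := by
          rw [hij, pow_add, pow_mul, hw.pow_eq_one]; simp
        rwa [pow_add, hi, one_mul] at h2
      rw [pow_two]
      refine (mul_dvd_mul ?_ ?_).mul_right _ <;> rw [PowerSeries.X_dvd_iff]
      · exact constantCoeff_gaussBinom_eq_zero h0 (by rw [pow_mul, hw.pow_eq_one, one_pow]) hwi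
      · exact constantCoeff_gaussBinom_eq_zero h0 hw.pow_eq_one hwj
    have hcoeff : ∀ d < 2,
        PowerSeries.coeff d (Polynomial.aeval q (gaussBinom (n * (A + 1)) (n * (M + 1)))) =
        PowerSeries.coeff d (Polynomial.aeval q (gaussBinom (n * A) (n * (M + 1))) *
          q ^ (n * (M + 1) * n)) +
        PowerSeries.coeff d (Polynomial.aeval q (gaussBinom (n * A) (n * M))) := by
      intro d hd
      rw [hsum, map_sum, Finset.sum_eq_add (n * (M + 1), 0) (n * M, n)]
      · simp [gaussBinom_zero_right, gaussBinom_self]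
      · simp [hn.ne]
      · exact fun x hx hne => PowerSeries.X_pow_dvd_iff.1 (hvanish x hx hne) d hd
      · simp
      · simp [mul_add_one]
    have hwn : w ^ (n * (M + 1) * n) = 1 := by rw [mul_assoc, pow_mul, hw.pow_eq_one, one_pow]
    obtain ⟨ih0, ih1⟩ := ih M
    obtain ⟨ihs0, ihs1⟩ := ih (M + 1)
    constructor
    · have h := hcoeff 0 (by omega)
      simp only [PowerSeries.coeff_zero_eq_constantCoeff_apply] at h
      rw [h, map_mul, map_pow, h0, ih0, ihs0, hwn, Nat.choose_succ_succ]
      push_cast; ring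
    · rw [hcoeff 1 (by omega), PowerSeries.coeff_one_mul, coeff_one_pow_of_coeff_one h0 h1,
        map_pow, h0, hwn, ih1, ihs1, ihs0, Nat.choose_succ_succ]
      have hch : ((A.choose (M + 1) : ℕ) : ℂ) * (M + 1) = A.choose M * (A - M) := by
        rcases le_or_gt M A with h | h
        · have := Nat.choose_succ_right_eq A M
          rw [← Nat.cast_sub h]; exact_mod_cast this
        · rw [Nat.choose_eq_zero_of_lt h, Nat.choose_eq_zero_of_lt (by omega)]; simp
      push_cast
      linear_combination (c * n ^ 2 / 2) * hch

lemma expandAt_symmBinom (ζ : ℂˣ) (k N M : ℕ) :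
    expandAt ζ (symmBinom k N M) = expandAt ζ (T (-(k * M * ((N - M : ℕ) : ℤ)))) *
      Polynomial.aeval (expandAt ζ (T (2 * k))) (gaussBinom N M) := by
  rw [symmBinom, map_mul, Polynomial.aeval_algHom_apply]

lemma constantCoeff_expandAt_T_two_mul (ζ : ℂˣ) (k : ℕ) :
    PowerSeries.constantCoeff (expandAt ζ (T (2 * k))) = ((ζ ^ 2) ^ k : ℂˣ) := by
  rw [← PowerSeries.coeff_zero_eq_constantCoeff_apply, coeff_zero_expandAt_T, zpow_mul]
  simp [zpow_ofNat]

lemma coeff_one_expandAt_T_two_mul (ζ : ℂˣ) (k : ℕ) :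
    PowerSeries.coeff 1 (expandAt ζ (T (2 * k))) = 2 * k * ((ζ ^ 2) ^ k : ℂˣ) := by
  rw [coeff_one_expandAt_T, zpow_mul]
  simp [zpow_ofNat]

lemma X_dvd_expandAt_symmBinom (ζ : ℂˣ) {k N M : ℕ} (hN : (ζ ^ 2) ^ (k * N) = 1)
    (hM : (ζ ^ 2) ^ (k * M) ≠ 1) : PowerSeries.X ∣ expandAt ζ (symmBinom k N M) := by
  rw [expandAt_symmBinom]
  refine Dvd.dvd.mul_left ?_ _
  rw [PowerSeries.X_dvd_iff]
  refine constantCoeff_gaussBinom_eq_zero (constantCoeff_expandAt_T_two_mul ζ k) ?_ ?_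
  · rw [← Units.val_pow_eq_pow_val, ← pow_mul, hN, Units.val_one]
  · rwa [← Units.val_pow_eq_pow_val, ← pow_mul, Ne, Units.val_eq_one]

lemma coeff_expandAt_symmBinom (ζ : ℂˣ) {k N M : ℕ} (hk : 0 < k) (hMN : M ≤ N)
    (hn : 0 < orderOf (ζ ^ 2)) (hN : orderOf (ζ ^ 2) ∣ k * N) (hM : orderOf (ζ ^ 2) ∣ k * M) :
    PowerSeries.coeff 0 (expandAt ζ (symmBinom k N M)) =
      (ζ : ℂ) ^ (-(k * M * ((N - M : ℕ) : ℤ))) *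
        (k * N / (orderOf (ζ ^ 2)).lcm k).choose (k * M / (orderOf (ζ ^ 2)).lcm k) ∧
    PowerSeries.coeff 1 (expandAt ζ (symmBinom k N M)) = 0 := by
  set n := orderOf (ζ ^ 2) with hndef
  obtain ⟨n', hn'⟩ : ∃ n', n' = orderOf ((ζ ^ 2) ^ k) := ⟨_, rfl⟩
  have hn'eq : n' = n / n.gcd k := by rw [hn', orderOf_pow' _ hk.ne']
  have hg : 0 < n.gcd k := Nat.gcd_pos_of_pos_left _ hn
  have hL : n.lcm k = k * n' := by
    rw [Nat.lcm, hn'eq, mul_comm n k, Nat.mul_div_assoc _ (Nat.gcd_dvd_left _ _)]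
  have hn'pos : 0 < n' := by
    rw [hn'eq]; exact Nat.div_pos (Nat.gcd_le_left _ hn) hg
  have hdvd : ∀ x, n ∣ k * x → n' ∣ x := by
    intro x hx
    rw [hn', orderOf_dvd_iff_pow_eq_one, ← pow_mul]
    exact orderOf_dvd_iff_pow_eq_one.1 hx
  obtain ⟨A, rfl⟩ := hdvd N hN
  obtain ⟨B, rfl⟩ := hdvd M hM
  have hw : IsPrimitiveRoot (((ζ ^ 2) ^ k : ℂˣ) : ℂ) n' := by
    rw [IsPrimitiveRoot.coe_units_iff, hn']
    exact IsPrimitiveRoot.orderOf _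
  have hBA : B ≤ A := Nat.le_of_mul_le_mul_left hMN hn'pos
  obtain ⟨c0, c1⟩ := coeff_gaussBinom_mul_mul (constantCoeff_expandAt_T_two_mul ζ k)
    (coeff_one_expandAt_T_two_mul ζ k) hn'pos hw A B
  rw [hL, ← mul_assoc, ← mul_assoc, Nat.mul_div_cancel_left _ (by positivity),
    Nat.mul_div_cancel_left _ (by positivity), expandAt_symmBinom]
  constructor
  · rw [PowerSeries.coeff_zero_eq_constantCoeff_apply, map_mul, c0,
      ← PowerSeries.coeff_zero_eq_constantCoeff_apply, coeff_zero_expandAt_T]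
  · rw [PowerSeries.coeff_one_mul, c0, c1, coeff_one_expandAt_T,
      ← PowerSeries.coeff_zero_eq_constantCoeff_apply, coeff_zero_expandAt_T, ← Nat.mul_sub]
    push_cast [Nat.cast_sub hBA]
    ring

/-! ### Cancellation of the leading terms -/

/-- A Möbius sum of a function that does not see the prime `p ∣ G` vanishes. -/
lemma sum_moebius_mul_eq_zero {G p : ℕ} (hG : G ≠ 0) (hp : p.Prime) (hpG : p ∣ G) (g : ℕ → ℂ)
    (hg : ∀ k, k * p ∣ G → ¬ p ∣ k → g (k * p) = g k) :
    ∑ k ∈ G.divisors, ((moebius k : ℤ) : ℂ) * g k = 0 := by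
  have hmul : ∀ k, ¬ p ∣ k → moebius (k * p) = -moebius k := by
    intro k hk
    rw [isMultiplicative_moebius.map_mul_of_coprime ((hp.coprime_iff_not_dvd.2 hk).symm),
      moebius_apply_prime hp]
    ring
  rw [← Finset.sum_filter_of_ne (p := Squarefree) (by
    intro k _ hk
    by_contra h
    exact hk (by simp [moebius_eq_zero_of_not_squarefree h]))]
  have hsq : ∀ k, Squarefree (k * p) → ¬ p ∣ k := by
    rintro _ h ⟨c, rfl⟩
    exact hp.not_isUnit (h p ⟨c, by ring⟩)
  refine Finset.sum_involution (fun k _ => if p ∣ k then k / p else k * p) ?_ ?_ ?_ ?_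
  · intro k hk
    rw [Finset.mem_filter, Nat.mem_divisors] at hk
    by_cases h : p ∣ k
    · obtain ⟨c, rfl⟩ := h
      rw [mul_comm p c] at hk ⊢
      have hc := hsq c hk.2
      simp only [dvd_mul_left, if_true, Nat.mul_div_cancel _ hp.pos]
      rw [hmul c hc, hg c hk.1.1 hc]
      push_cast; ring
    · have hkp : k * p ∣ G :=
        (hp.coprime_iff_not_dvd.2 h).symm.mul_dvd_of_dvd_of_dvd hk.1.1 hpG
      simp only [h, if_false]
      rw [hmul k h, hg k hkp h]
      push_cast; ring
  · intro k hk _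
    rw [Finset.mem_filter, Nat.mem_divisors] at hk
    have hk0 : 0 < k := Nat.pos_of_ne_zero hk.2.ne_zero
    split_ifs with h
    · exact (Nat.div_lt_self hk0 hp.one_lt).ne
    · exact ((Nat.lt_mul_iff_one_lt_right hk0).2 hp.one_lt).ne'
  · intro k hk
    rw [Finset.mem_filter, Nat.mem_divisors] at hk ⊢
    split_ifs with h
    · have hd : k / p ∣ k := Nat.div_dvd_of_dvd h
      exact ⟨⟨hd.trans hk.1.1, hG⟩, hk.2.squarefree_of_dvd hd⟩
    · have hcop := (hp.coprime_iff_not_dvd.2 h).symm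
      exact ⟨⟨hcop.mul_dvd_of_dvd_of_dvd hk.1.1 hpG, hG⟩,
        (Nat.squarefree_mul hcop).2 ⟨hk.2, hp.squarefree⟩⟩
  · intro k hk
    rw [Finset.mem_filter] at hk
    by_cases h : p ∣ k
    · obtain ⟨c, rfl⟩ := h
      rw [mul_comm p c] at hk ⊢
      simp [hsq c hk.2, hp.pos]
    · simp [h, hp.pos]

lemma pow_orderOf_sq_eq_neg_one (ζ : ℂˣ) (hn : 0 < orderOf (ζ ^ 2)) (h2 : 2 ∣ orderOf (ζ ^ 2)) :
    (ζ : ℂ) ^ orderOf (ζ ^ 2) = -1 := by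
  obtain ⟨j, hj⟩ := h2
  have hsq : ((ζ : ℂ) ^ orderOf (ζ ^ 2)) ^ 2 = 1 := by
    have h := congrArg Units.val (pow_orderOf_eq_one (ζ ^ 2))
    push_cast at h
    rw [← h]; ring
  rcases sq_eq_sq_iff_eq_or_eq_neg.1 (hsq.trans (one_pow 2).symm) with h | h
  · exfalso
    have h1 : (ζ ^ 2) ^ j = 1 := by
      ext
      push_cast
      rw [← pow_mul, ← hj, h]
    have := Nat.le_of_dvd (by omega) (orderOf_dvd_of_pow_eq_one h1)
    omega
  · exact h

/-- Parity of the exponents occurring in the leading terms. -/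
lemma even_signExponent {a b : ℕ} (hab : a.Coprime b) (δ η : ℤ) :
    Even (((a + b) * δ + η) -
      (a * δ * ((b - 1) * δ + η) - (δ - η) * (a * δ - (δ - η)))) := by
  have h : Even (((a : ℤ) + 1) * (b + 1)) := by
    rcases Nat.even_or_odd a with ha | ha
    · rcases Nat.even_or_odd b with hb | hb
      · exact absurd (hab ▸ Nat.dvd_gcd ha.two_dvd hb.two_dvd) (by norm_num)
      · exact Even.mul_left (by exact_mod_cast hb.add_one) _
    · exact Even.mul_right (by exact_mod_cast ha.add_one) _
  rcases h with ⟨c, hc⟩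
  obtain ⟨e, he⟩ := Int.even_mul_succ_self δ
  obtain ⟨f, hf⟩ := Int.even_mul_succ_self η
  refine ⟨c * δ + η - (a * b + 1) * e - f + a * δ ^ 2 - a * δ * η + δ * η, ?_⟩
  linear_combination δ * hc - (a * b + 1) * he - hf

/-- The sign of the leading term does not change when `k` is multiplied by a prime `p ∤ k`
dividing the order of `ζ ^ 2`. -/
lemma sign_mul_zpow_eq (ζ : ℂˣ) {k p r : ℕ} (hp : p.Prime) (hn : 0 < orderOf (ζ ^ 2))
    (hpn : p ∣ orderOf (ζ ^ 2)) (hpk : ¬ p ∣ k) (hL : orderOf (ζ ^ 2) ∣ k * p * r) (S : ℕ)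
    (Q : ℤ) (hSQ : Even (S - Q)) :
    (-1 : ℂ) ^ (p * r * S) * (ζ : ℂ) ^ ((k * p * r : ℕ) * (p * r * Q)) =
      (-1) ^ (r * S) * (ζ : ℂ) ^ ((k * p * r : ℕ) * (r * Q)) := by
  have hε : ((ζ : ℂ) ^ (k * p * r)) ^ 2 = 1 := by
    have h := congrArg Units.val (orderOf_dvd_iff_pow_eq_one.1 hL)
    push_cast at h
    rw [← h]; ring
  rw [zpow_mul _ _ (p * r * Q), zpow_mul _ _ (r * Q), zpow_natCast]
  rcases hp.eq_two_or_odd' with rfl | hodd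
  · have hkodd : Odd k := by
      rwa [← Nat.not_even_iff_odd, even_iff_two_dvd]
    rcases Nat.even_or_odd r with hr | hr
    · obtain ⟨s, rfl⟩ := hr
      have h1 : ∀ x : ℤ, ((ζ : ℂ) ^ (k * 2 * (s + s))) ^ (2 * x) = 1 := fun x => by
        rw [zpow_mul, zpow_ofNat, hε, one_zpow]
      rw [show ((2 : ℕ) : ℤ) * ((s + s : ℕ) : ℤ) * Q = 2 * ((s + s : ℕ) * Q) by push_cast; ring,
        show ((s + s : ℕ) : ℤ) * Q = 2 * (s * Q) by push_cast; ring, h1, h1,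
        show 2 * (s + s) * S = 2 * ((s + s) * S) by ring,
        show (s + s) * S = 2 * (s * S) by ring, pow_mul, pow_mul]
      simp
    · have hε1 : (ζ : ℂ) ^ (k * 2 * r) = -1 := by
        obtain ⟨l, hl⟩ := hL
        have hlodd : Odd l := by
          obtain ⟨j, hj⟩ := hpn
          rw [hj] at hl
          have h3 : k * r = j * l := by
            apply Nat.eq_of_mul_eq_mul_left two_pos
            linarith
          exact (Nat.odd_mul.1 (h3 ▸ hkodd.mul hr)).2
        rw [hl, pow_mul, pow_orderOf_sq_eq_neg_one ζ hn hpn, hlodd.neg_one_pow]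
      have hzpow : ∀ (x : ℕ) (y : ℤ), Even (x + y) → (-1 : ℂ) ^ x * (-1 : ℂ) ^ y = 1 := by
        intro x y hxy
        rw [← zpow_natCast, ← zpow_add₀ (by norm_num), hxy.neg_one_zpow]
      obtain ⟨c, hc⟩ := hSQ
      rw [hε1, hzpow, hzpow]
      · refine ⟨r * (c + Q), ?_⟩
        push_cast
        linear_combination (r : ℤ) * hc
      · refine ⟨r * (S + Q), ?_⟩
        push_cast; ring
  · obtain ⟨c, rfl⟩ := hodd
    congr 1
    · rw [show (2 * c + 1) * r * S = 2 * (c * r * S) + r * S by ring, pow_add, pow_mul]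
      simp
    · have hne : (ζ : ℂ) ^ (k * (2 * c + 1) * r) ≠ 0 := pow_ne_zero _ ζ.ne_zero
      rw [show ((2 * c + 1 : ℕ) : ℤ) * r * Q = 2 * (c * r * Q) + r * Q by push_cast; ring,
        zpow_add₀ hne, zpow_mul, zpow_ofNat, hε, one_zpow, one_mul]

lemma leadingSign_eq (ζ : ℂˣ) {a b δ η j s : ℕ} (ha : 0 < a) (hb : 0 < b) (hj : 0 < j)
    (hηδ : η ≤ δ) {d₀ d₁ : ℕ} (hd₀ : d₀ = j * s * δ) (hd₁ : d₁ = j * s * η) :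
    (-1 : ℂ) ^ (((a + b) * d₀ + d₁) / j + 1) * (ζ : ℂ) ^ (a * d₀ * ((b - 1) * d₀ + d₁) / j) *
        (ζ : ℂ) ^ (-((j : ℤ) * ((d₀ - d₁) / j : ℕ) *
          ((a * d₀ / j - (d₀ - d₁) / j : ℕ) : ℤ))) =
      -((-1) ^ (s * ((a + b) * δ + η)) * (ζ : ℂ) ^ ((j * s : ℕ) * (s *
        ((a : ℤ) * δ * ((b - 1) * δ + η) - (δ - η) * (a * δ - (δ - η)))))) := by
  obtain ⟨b, rfl⟩ : ∃ c, b = c + 1 := ⟨b - 1, by omega⟩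
  obtain ⟨m, rfl⟩ := Nat.exists_eq_add_of_le hηδ
  have e1 : ((a + (b + 1)) * d₀ + d₁) / j = s * ((a + (b + 1)) * (η + m) + η) := by
    rw [show (a + (b + 1)) * d₀ + d₁ = j * (s * ((a + (b + 1)) * (η + m) + η)) by
      rw [hd₀, hd₁]; ring, Nat.mul_div_cancel_left _ hj]
  have e2 : a * d₀ * ((b + 1 - 1) * d₀ + d₁) / j =
      j * s * (s * (a * (η + m) * (b * (η + m) + η))) := by
    rw [Nat.add_sub_cancel, show a * d₀ * (b * d₀ + d₁) =
      j * (j * s * (s * (a * (η + m) * (b * (η + m) + η)))) by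
      rw [hd₀, hd₁]; ring, Nat.mul_div_cancel_left _ hj]
  have e3 : (d₀ - d₁) / j = s * m := by
    rw [show d₀ - d₁ = j * (s * m) by rw [hd₀, hd₁, ← Nat.mul_sub, Nat.add_sub_cancel_left]; ring,
      Nat.mul_div_cancel_left _ hj]
  have e4 : a * d₀ / j = s * (a * (η + m)) := by
    rw [show a * d₀ = j * (s * (a * (η + m))) by rw [hd₀]; ring, Nat.mul_div_cancel_left _ hj]
  have hle : s * m ≤ s * (a * (η + m)) := by
    apply Nat.mul_le_mul_left
    nlinarith
  rw [e1, e2, e3, e4, pow_succ, ← zpow_natCast (ζ : ℂ), mul_assoc, ← zpow_add₀ ζ.ne_zero]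
  rw [show ((j * s * (s * (a * (η + m) * (b * (η + m) + η))) : ℕ) : ℤ) +
      -((j : ℤ) * (s * m : ℕ) * ((s * (a * (η + m)) - s * m : ℕ) : ℤ)) =
      (j * s : ℕ) * (s * ((a : ℤ) * (η + m : ℕ) * (((b + 1 : ℕ) - 1) * (η + m : ℕ) + η) -
        ((η + m : ℕ) - η) * (a * (η + m : ℕ) - ((η + m : ℕ) - η)))) by
    rw [Nat.cast_sub hle]; push_cast; ring]
  ring

lemma leadingSign_mul_prime (ζ : ℂˣ) {a b d₀ d₁ k p : ℕ} (ha : 0 < a) (hb : 0 < b)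
    (hab : a.Coprime b) (hd₀ : 0 < d₀) (hd₁ : d₁ ≤ d₀) (hp : p.Prime)
    (hn : orderOf (ζ ^ 2) ∣ d₀.gcd d₁) (hpn : p ∣ orderOf (ζ ^ 2)) (hpk : ¬ p ∣ k)
    (hkp : k * p ∣ d₀.gcd d₁) :
    (-1 : ℂ) ^ (((a + b) * d₀ + d₁) / (k * p) + 1) *
        (ζ : ℂ) ^ (a * d₀ * ((b - 1) * d₀ + d₁) / (k * p)) *
        (ζ : ℂ) ^ (-(((k * p : ℕ) : ℤ) * ((d₀ - d₁) / (k * p) : ℕ) *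
          ((a * d₀ / (k * p) - (d₀ - d₁) / (k * p) : ℕ) : ℤ))) =
      (-1 : ℂ) ^ (((a + b) * d₀ + d₁) / k + 1) *
        (ζ : ℂ) ^ (a * d₀ * ((b - 1) * d₀ + d₁) / k) *
        (ζ : ℂ) ^ (-((k : ℤ) * ((d₀ - d₁) / k : ℕ) *
          ((a * d₀ / k - (d₀ - d₁) / k : ℕ) : ℤ))) := by
  have hG : 0 < d₀.gcd d₁ := Nat.gcd_pos_of_pos_left _ hd₀
  have hkpos : 0 < k := Nat.pos_of_ne_zero (by rintro rfl; simp at hpk)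
  obtain ⟨r, hr⟩ := Nat.dvd_lcm_right (orderOf (ζ ^ 2)) (k * p)
  have hLG : k * p * r ∣ d₀.gcd d₁ := hr ▸ Nat.lcm_dvd hn hkp
  have hnL : orderOf (ζ ^ 2) ∣ k * p * r := hr ▸ Nat.dvd_lcm_left _ _
  obtain ⟨δ, hδ⟩ := hLG.trans (Nat.gcd_dvd_left _ _)
  obtain ⟨η, hη⟩ := hLG.trans (Nat.gcd_dvd_right _ _)
  have hηδ : η ≤ δ :=
    Nat.le_of_mul_le_mul_left (hη ▸ hδ ▸ hd₁) (Nat.pos_of_dvd_of_pos hLG hG)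
  rw [leadingSign_eq ζ ha hb (Nat.mul_pos hkpos hp.pos) hηδ hδ hη,
    leadingSign_eq ζ (s := p * r) ha hb hkpos hηδ (by rw [hδ]; ring) (by rw [hη]; ring)]
  have h := sign_mul_zpow_eq ζ hp (Nat.pos_of_dvd_of_pos hn hG) hpn hpk hnL ((a + b) * δ + η)
    ((a : ℤ) * δ * ((b - 1) * δ + η) - (δ - η) * (a * δ - (δ - η)))
    (by exact_mod_cast even_signExponent hab δ η)
  rw [← h, ← mul_assoc k p r]
  push_cast
  rfl

/-! ### The local divisibilities -/

/-- The `k`-th summand of the multiple cover formula. -/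
def coverTerm (a b d₀ d₁ k : ℕ) : LaurentPolynomial ℤ :=
  (k : LaurentPolynomial ℤ) * ((moebius k : ℤ) : LaurentPolynomial ℤ) *
    (-1) ^ (((a + b) * d₀ + d₁) / k + 1) *
    qint ((a * d₀ * ((b - 1) * d₀ + d₁) / k : ℕ) : ℤ) *
    symmBinom (k : ℤ) (a * d₀ / k) ((d₀ - d₁) / k)

lemma expandAt_coverTerm (ζ : ℂˣ) (a b d₀ d₁ k : ℕ) :
    expandAt ζ (coverTerm a b d₀ d₁ k) =
      PowerSeries.C ((k : ℂ) * ((moebius k : ℤ) : ℂ) * (-1) ^ (((a + b) * d₀ + d₁) / k + 1)) *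
      (expandAt ζ (qint ((a * d₀ * ((b - 1) * d₀ + d₁) / k : ℕ) : ℤ)) *
        expandAt ζ (symmBinom (k : ℤ) (a * d₀ / k) ((d₀ - d₁) / k))) := by
  simp [coverTerm, mul_assoc]

lemma dvd_mul_div_of_dvd_or {n k x y : ℕ} (hx : k ∣ x) (hy : k ∣ y) (h : n ∣ x ∨ n ∣ y) :
    n ∣ x * y / k := by
  rcases h with h | h
  · rw [Nat.mul_div_assoc _ hy]; exact h.mul_right _
  · rw [mul_comm, Nat.mul_div_assoc _ hx]; exact h.mul_right _

section

variable {a b d₀ d₁ k : ℕ}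

lemma X_dvd_expandAt_qint_div (ζ : ℂˣ) (hk : k ∣ d₀.gcd d₁)
    (h : orderOf (ζ ^ 2) ∣ a * d₀ ∨ orderOf (ζ ^ 2) ∣ (b - 1) * d₀ + d₁) :
    PowerSeries.X ∣ expandAt ζ (qint ((a * d₀ * ((b - 1) * d₀ + d₁) / k : ℕ) : ℤ)) := by
  have h0 := hk.trans (Nat.gcd_dvd_left _ _)
  have h1 := hk.trans (Nat.gcd_dvd_right _ _)
  exact X_dvd_expandAt_qint ζ (orderOf_dvd_iff_pow_eq_one.1
    (dvd_mul_div_of_dvd_or (h0.mul_left _) ((h0.mul_left _).add h1) h))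

lemma X_dvd_expandAt_coverTerm (ζ : ℂˣ) (hk : k ∣ d₀.gcd d₁)
    (h : orderOf (ζ ^ 2) ∣ a * d₀ ∨ orderOf (ζ ^ 2) ∣ (b - 1) * d₀ + d₁) :
    PowerSeries.X ∣ expandAt ζ (coverTerm a b d₀ d₁ k) := by
  rw [expandAt_coverTerm]
  exact ((X_dvd_expandAt_qint_div ζ hk h).mul_right _).mul_left _

lemma X_sq_dvd_expandAt_coverTerm (ζ : ℂˣ) (hk : k ∣ d₀.gcd d₁)
    (hA : orderOf (ζ ^ 2) ∣ a * d₀) (hm : ¬ orderOf (ζ ^ 2) ∣ d₀ - d₁) :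
    PowerSeries.X ^ 2 ∣ expandAt ζ (coverTerm a b d₀ d₁ k) := by
  have h0 := hk.trans (Nat.gcd_dvd_left _ _)
  have h1 := hk.trans (Nat.gcd_dvd_right _ _)
  rw [expandAt_coverTerm, pow_two]
  refine (mul_dvd_mul (X_dvd_expandAt_qint_div ζ hk (Or.inl hA))
    (X_dvd_expandAt_symmBinom ζ ?_ ?_)).mul_left _
  · rwa [Nat.mul_div_cancel' (h0.mul_left _), ← orderOf_dvd_iff_pow_eq_one]
  · rwa [Nat.mul_div_cancel' (Nat.dvd_sub h0 h1), Ne, ← orderOf_dvd_iff_pow_eq_one]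

lemma coeff_expandAt_coverTerm (ζ : ℂˣ) (ha : 0 < a) (hd₀ : 0 < d₀) (hk : k ∣ d₀.gcd d₁)
    (hn : orderOf (ζ ^ 2) ∣ d₀.gcd d₁) :
    PowerSeries.coeff 1 (expandAt ζ (coverTerm a b d₀ d₁ k)) =
      2 * (a * d₀ * ((b - 1) * d₀ + d₁) : ℕ) * (((moebius k : ℤ) : ℂ) *
        ((-1 : ℂ) ^ (((a + b) * d₀ + d₁) / k + 1) *
        (ζ : ℂ) ^ (a * d₀ * ((b - 1) * d₀ + d₁) / k) *
        (ζ : ℂ) ^ (-((k : ℤ) * ((d₀ - d₁) / k : ℕ) *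
          ((a * d₀ / k - (d₀ - d₁) / k : ℕ) : ℤ))) *
        (a * d₀ / (orderOf (ζ ^ 2)).lcm k).choose ((d₀ - d₁) / (orderOf (ζ ^ 2)).lcm k))) ∧
    PowerSeries.coeff 2 (expandAt ζ (coverTerm a b d₀ d₁ k)) = 0 := by
  have hG : 0 < d₀.gcd d₁ := Nat.gcd_pos_of_pos_left _ hd₀
  have hkpos := Nat.pos_of_dvd_of_pos hk hG
  have h0 := hk.trans (Nat.gcd_dvd_left _ _)
  have h1 := hk.trans (Nat.gcd_dvd_right _ _)
  have hn0 := hn.trans (Nat.gcd_dvd_left _ _)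
  have hn1 := hn.trans (Nat.gcd_dvd_right _ _)
  have hkA : k ∣ a * d₀ := h0.mul_left _
  have hkm : k ∣ d₀ - d₁ := Nat.dvd_sub h0 h1
  have hkAB : k ∣ a * d₀ * ((b - 1) * d₀ + d₁) := hkA.mul_right _
  obtain ⟨p0, p1, p2⟩ := coeff_expandAt_qint ζ (orderOf_dvd_iff_pow_eq_one.1
    (dvd_mul_div_of_dvd_or (y := (b - 1) * d₀ + d₁) hkA ((h0.mul_left _).add h1)
      (Or.inl (hn0.mul_left a))))
  have hle : (d₀ - d₁) / k ≤ a * d₀ / k :=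
    Nat.div_le_div_right ((Nat.sub_le _ _).trans (Nat.le_mul_of_pos_left _ ha))
  obtain ⟨q0, q1⟩ := coeff_expandAt_symmBinom ζ hkpos hle (Nat.pos_of_dvd_of_pos hn hG)
    (by rw [Nat.mul_div_cancel' hkA]; exact hn0.mul_left _)
    (by rw [Nat.mul_div_cancel' hkm]; exact Nat.dvd_sub hn0 hn1)
  rw [Nat.mul_div_cancel' hkA, Nat.mul_div_cancel' hkm] at q0
  rw [expandAt_coverTerm, PowerSeries.coeff_C_mul, PowerSeries.coeff_C_mul]
  constructor
  · rw [PowerSeries.coeff_one_mul, ← PowerSeries.coeff_zero_eq_constantCoeff_apply,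
      ← PowerSeries.coeff_zero_eq_constantCoeff_apply, p0, p1, q0]
    have hkC : ((a * d₀ * ((b - 1) * d₀ + d₁) : ℕ) : ℂ) =
        k * (a * d₀ * ((b - 1) * d₀ + d₁) / k : ℕ) := by
      rw [← Nat.cast_mul, Nat.mul_div_cancel' hkAB]
    rw [hkC]
    ring
  · rw [PowerSeries.coeff_mul, Finset.Nat.sum_antidiagonal_eq_sum_range_succ_mk]
    simp only [Finset.sum_range_succ, Finset.sum_range_zero, p0, p1, p2, q1, Nat.sub_zero,
      Nat.succ_sub_succ_eq_sub]
    simp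

lemma X_pow_three_dvd_sum_expandAt_coverTerm (ζ : ℂˣ) (ha : 0 < a) (hb : 0 < b)
    (hab : a.Coprime b) (hd₀ : 0 < d₀) (hd₁ : d₁ ≤ d₀) (hn : orderOf (ζ ^ 2) ∣ d₀.gcd d₁)
    (hn1 : orderOf (ζ ^ 2) ≠ 1) :
    PowerSeries.X ^ 3 ∣ ∑ k ∈ (d₀.gcd d₁).divisors, expandAt ζ (coverTerm a b d₀ d₁ k) := by
  obtain ⟨p, hp, hpn⟩ := Nat.exists_prime_and_dvd hn1
  have hG : d₀.gcd d₁ ≠ 0 := (Nat.gcd_pos_of_pos_left _ hd₀).ne'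
  have hA := (hn.trans (Nat.gcd_dvd_left _ _)).mul_left a
  rw [PowerSeries.X_pow_dvd_iff]
  intro j hj
  rw [map_sum]
  interval_cases j
  · refine Finset.sum_eq_zero fun k hk => ?_
    have := X_dvd_expandAt_coverTerm (b := b) ζ (Nat.dvd_of_mem_divisors hk) (Or.inl hA)
    rwa [PowerSeries.X_dvd_iff, ← PowerSeries.coeff_zero_eq_constantCoeff_apply] at this
  · rw [Finset.sum_congr rfl fun k hk => (coeff_expandAt_coverTerm (b := b) ζ ha hd₀
      (Nat.dvd_of_mem_divisors hk) hn).1, ← Finset.mul_sum,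
      sum_moebius_mul_eq_zero hG hp (hpn.trans hn), mul_zero]
    intro k hkp hpk
    have hlcm : (orderOf (ζ ^ 2)).lcm (k * p) = (orderOf (ζ ^ 2)).lcm k := by
      refine Nat.dvd_antisymm (Nat.lcm_dvd (Nat.dvd_lcm_left _ _) ?_)
        (Nat.lcm_dvd (Nat.dvd_lcm_left _ _) ((Dvd.intro _ rfl).trans (Nat.dvd_lcm_right _ _)))
      exact (hp.coprime_iff_not_dvd.2 hpk).symm.mul_dvd_of_dvd_of_dvd (Nat.dvd_lcm_right _ _)
        (hpn.trans (Nat.dvd_lcm_left _ _))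
    rw [hlcm, leadingSign_mul_prime ζ ha hb hab hd₀ hd₁ hp hn hpn hpk hkp]
  · exact Finset.sum_eq_zero fun k hk => (coeff_expandAt_coverTerm ζ ha hd₀
      (Nat.dvd_of_mem_divisors hk) hn).2

end

theorem bps_integrality_Y3ab (a b d₀ d₁ : ℕ) (ha : 0 < a) (hb : 0 < b)
    (hab : Nat.Coprime a b) (hd₀ : 1 ≤ d₀) (hd₁ : d₁ ≤ d₀)
    (hD₂ : 1 ≤ (b - 1) * d₀ + d₁) :
    qint (d₀ : ℤ) * qint (((b - 1) * d₀ + d₁ : ℕ) : ℤ) * qint ((a * d₀ : ℕ) : ℤ) ∣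
      qint 1 ^ 2 *
        ∑ k ∈ (Nat.gcd d₀ d₁).divisors,
          (k : LaurentPolynomial ℤ) * ((moebius k : ℤ) : LaurentPolynomial ℤ) *
            (-1) ^ (((a + b) * d₀ + d₁) / k + 1) *
            qint ((a * d₀ * ((b - 1) * d₀ + d₁) / k : ℕ) : ℤ) *
            symmBinom (k : ℤ) (a * d₀ / k) ((d₀ - d₁) / k) := by
  refine qint_mul_dvd_of_expandAt_dvd (by omega) (by omega) (by positivity) fun ζ => ?_
  change _ ∣ expandAt ζ (qint 1 ^ 2 * ∑ k ∈ (Nat.gcd d₀ d₁).divisors, coverTerm a b d₀ d₁ k)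
  have hx := expandAt_qint_dvd_X ζ (n := d₀) (by omega)
  have hy := expandAt_qint_dvd_X ζ (n := (b - 1) * d₀ + d₁) (by omega)
  have hz := expandAt_qint_dvd_X ζ (n := a * d₀) (by positivity)
  have hunit : ∀ {n : ℕ}, ¬ orderOf (ζ ^ 2) ∣ n → expandAt ζ (qint n) ∣ 1 := fun h =>
    (isUnit_expandAt_qint ζ (by rwa [Ne, ← orderOf_dvd_iff_pow_eq_one])).dvd
  simp only [map_mul, map_pow, map_sum]
  by_cases h0 : orderOf (ζ ^ 2) ∣ d₀
  · have hA : orderOf (ζ ^ 2) ∣ a * d₀ := h0.mul_left _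
    by_cases hB : orderOf (ζ ^ 2) ∣ (b - 1) * d₀ + d₁
    · have h1 : orderOf (ζ ^ 2) ∣ d₁ := (Nat.dvd_add_right (h0.mul_left _)).1 hB
      refine (mul_dvd_mul (mul_dvd_mul hx hy) hz).trans ?_
      by_cases hn1 : orderOf (ζ ^ 2) = 1
      · rw [← pow_two]
        refine mul_dvd_mul (pow_dvd_pow_of_dvd ?_ 2) (Finset.dvd_sum fun k hk =>
          X_dvd_expandAt_coverTerm ζ (Nat.dvd_of_mem_divisors hk) (Or.inl hA))
        exact X_dvd_expandAt_qint (n := 1) ζ (by rw [pow_one, ← orderOf_eq_one_iff, hn1])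
      · rw [← pow_two, ← pow_succ]
        exact (X_pow_three_dvd_sum_expandAt_coverTerm ζ ha hb hab hd₀ hd₁
          (Nat.dvd_gcd h0 h1) hn1).mul_left _
    · have hm : ¬ orderOf (ζ ^ 2) ∣ d₀ - d₁ := fun h =>
        hB ((h0.mul_left _).add ((Nat.dvd_sub_iff_right hd₁ h0).1 h))
      refine (mul_dvd_mul (mul_dvd_mul hx (hunit hB)) hz).trans ?_
      rw [mul_one, ← pow_two]
      exact (Finset.dvd_sum fun k hk =>
        X_sq_dvd_expandAt_coverTerm ζ (Nat.dvd_of_mem_divisors hk) hA hm).mul_left _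
  · by_cases hA : orderOf (ζ ^ 2) ∣ a * d₀
    · by_cases hB : orderOf (ζ ^ 2) ∣ (b - 1) * d₀ + d₁
      · have hm : ¬ orderOf (ζ ^ 2) ∣ d₀ - d₁ := by
          intro h
          apply h0
          have hbd : orderOf (ζ ^ 2) ∣ b * d₀ := by
            have hsum : b * d₀ = (b - 1) * d₀ + d₁ + (d₀ - d₁) := by
              obtain ⟨c, rfl⟩ : ∃ c, b = c + 1 := ⟨b - 1, by omega⟩
              rw [Nat.add_sub_cancel, add_one_mul]
              omega
            exact hsum ▸ hB.add h
          have := Nat.dvd_gcd hA hbd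
          rwa [Nat.gcd_mul_right, hab.gcd_eq_one, one_mul] at this
        refine (mul_dvd_mul (mul_dvd_mul (hunit h0) hy) hz).trans ?_
        rw [one_mul, ← pow_two]
        exact (Finset.dvd_sum fun k hk =>
          X_sq_dvd_expandAt_coverTerm ζ (Nat.dvd_of_mem_divisors hk) hA hm).mul_left _
      · refine (mul_dvd_mul (mul_dvd_mul (hunit h0) (hunit hB)) hz).trans ?_
        rw [one_mul, one_mul]
        exact (Finset.dvd_sum fun k hk =>
          X_dvd_expandAt_coverTerm ζ (Nat.dvd_of_mem_divisors hk) (Or.inl hA)).mul_left _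
    · by_cases hB : orderOf (ζ ^ 2) ∣ (b - 1) * d₀ + d₁
      · refine (mul_dvd_mul (mul_dvd_mul (hunit h0) hy) (hunit hA)).trans ?_
        rw [one_mul, mul_one]
        exact (Finset.dvd_sum fun k hk =>
          X_dvd_expandAt_coverTerm ζ (Nat.dvd_of_mem_divisors hk) (Or.inr hB)).mul_left _
      · refine (mul_dvd_mul (mul_dvd_mul (hunit h0) (hunit hB)) (hunit hA)).trans ?_
        rw [one_mul, one_mul]
        exact one_dvd _
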